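/- Let 0 < δ < 1, λ > 0, and let a : [0,∞) → ℝ be continuously differentiable with a(s) ≥ λ and a'(s)·s ≥ −((1−δ)/2)·a(s) for all s ≥ 0. Then the function P : ℝ³ → ℝ defined by P(z) = ∫₀^{|z|²} a(s) ds is strictly convex on ℝ³. -/

import Mathlib

open Set

/-- A strictly convex, strictly increasing function of the norm of a strictly convex space is
strictly convex. -/
theorem StrictConvexOn.comp_norm {E : Type*} [NormedAddCommGroup E] [NormedSpace ℝ E]
    [StrictConvexSpace ℝ E] {g : ℝ → ℝ} (hg : StrictConvexOn ℝ (Ici 0) g)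
    (hmono : StrictMonoOn g (Ici 0)) : StrictConvexOn ℝ univ (fun z : E => g ‖z‖) := by
  refine ⟨convex_univ, fun x _ y _ hxy α β hα hβ hαβ => ?_⟩
  by_cases hn : ‖x‖ = ‖y‖
  · have hlt : ‖α • x + β • y‖ < ‖y‖ :=
      norm_combo_lt_of_ne hn.le le_rfl hxy hα hβ hαβ
    have hg_lt := hmono (norm_nonneg _) (norm_nonneg y) hlt
    simp only [hn, smul_eq_mul]
    rwa [← add_mul, hαβ, one_mul]
  · have hle : ‖α • x + β • y‖ ≤ α • ‖x‖ + β • ‖y‖ := by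
      refine (norm_add_le _ _).trans_eq ?_
      rw [norm_smul_of_nonneg hα.le, norm_smul_of_nonneg hβ.le, smul_eq_mul, smul_eq_mul]
    exact (hmono.monotoneOn (norm_nonneg _) ((norm_nonneg _).trans hle) hle).trans_lt
      (hg.2 (norm_nonneg x) (norm_nonneg y) hn hα hβ hαβ)

theorem HasDerivAt.comp_sq {f : ℝ → ℝ} {f' r : ℝ} (hf : HasDerivAt f f' (r ^ 2)) :
    HasDerivAt (fun r => f (r ^ 2)) (f' * (2 * r)) r := by
  have h : HasDerivAt (fun r : ℝ => r ^ 2) (2 * r) r := by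
    simpa using hasDerivAt_pow 2 r
  exact HasDerivAt.comp (h := fun r : ℝ => r ^ 2) r hf h

/-- If `0 < δ < 1`, `λ > 0`, and `a : [0,∞) → ℝ` is continuously differentiable with
`a(s) ≥ λ` and `a'(s)·s ≥ −((1−δ)/2)·a(s)` for all `s ≥ 0`, then the potential
`P(z) = ∫₀^{|z|²} a(s) ds` is strictly convex on `ℝ³`. -/
theorem stmt_8 (δ lam : ℝ) (hδ0 : 0 < δ) (hδ1 : δ < 1) (hlam : 0 < lam)
    (a a' : ℝ → ℝ)
    (hderiv : ∀ s : ℝ, 0 ≤ s → HasDerivWithinAt a (a' s) (Set.Ici 0) s)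
    (hcont : ContinuousOn a' (Set.Ici 0))
    (hlb : ∀ s : ℝ, 0 ≤ s → lam ≤ a s)
    (hstruct : ∀ s : ℝ, 0 ≤ s → -((1 - δ) / 2) * a s ≤ a' s * s) :
    StrictConvexOn ℝ Set.univ
      (fun z : EuclideanSpace ℝ (Fin 3) => ∫ s in (0:ℝ)..(‖z‖ ^ 2), a s) := by
  have hac : ContinuousOn a (Ici 0) := fun s hs => (hderiv s hs).continuousWithinAt
  set b : ℝ → ℝ := fun s => a (max s 0) with hb_def
  have hb : Continuous b :=
    hac.comp_continuous (continuous_id.max continuous_const) fun s => le_max_right s 0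
  have hba : ∀ s, 0 ≤ s → b s = a s := fun s hs => by simp [hb_def, hs]
  set g : ℝ → ℝ := fun r => ∫ s in (0 : ℝ)..(r ^ 2), b s with hg_def
  have hg : ∀ r, HasDerivAt g (b (r ^ 2) * (2 * r)) r := fun r =>
    (hb.integral_hasStrictDerivAt 0 (r ^ 2)).hasDerivAt.comp_sq
  have hg_cont : ContinuousOn g (Ici 0) := fun r _ => (hg r).continuousAt.continuousWithinAt
  have hderiv_g : deriv g = fun r => b (r ^ 2) * (2 * r) := funext fun r => (hg r).deriv
  have hmono : StrictMonoOn g (Ici 0) := by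
    refine strictMonoOn_of_deriv_pos (convex_Ici 0) hg_cont fun r hr => ?_
    rw [interior_Ici, mem_Ioi] at hr
    rw [hderiv_g]
    have h := hlb (r ^ 2) (sq_nonneg r)
    simp only [hba _ (sq_nonneg r)]
    have : 0 < a (r ^ 2) := hlam.trans_le h
    positivity
  have hmono' : StrictMonoOn (deriv g) (interior (Ici 0)) := by
    rw [hderiv_g, interior_Ici]
    refine strictMonoOn_of_deriv_pos (convex_Ioi 0) (by fun_prop) fun r hr => ?_
    rw [interior_Ioi, mem_Ioi] at hr
    have hr2 : 0 < r ^ 2 := by positivity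
    have hb' : HasDerivAt b (a' (r ^ 2)) (r ^ 2) := by
      refine ((hderiv _ hr2.le).hasDerivAt (Ici_mem_nhds hr2)).congr_of_eventuallyEq ?_
      filter_upwards [Ici_mem_nhds hr2] with s hs using hba s hs
    have hd : HasDerivAt (fun r => b (r ^ 2) * (2 * r))
        (a' (r ^ 2) * (2 * r) * (2 * r) + b (r ^ 2) * 2) r := by
      simpa using hb'.comp_sq.fun_mul ((hasDerivAt_id' r).const_mul 2)
    rw [hd.deriv, hba _ hr2.le]
    have h₂ := hstruct _ hr2.le
    have h₃ : 0 < δ * a (r ^ 2) := mul_pos hδ0 (hlam.trans_le (hlb _ hr2.le))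
    nlinarith
  have hconv : StrictConvexOn ℝ (Ici 0) g :=
    hmono'.strictConvexOn_of_deriv (convex_Ici 0) hg_cont
  have hP : (fun z : EuclideanSpace ℝ (Fin 3) => ∫ s in (0:ℝ)..(‖z‖ ^ 2), a s) =
      fun z => g ‖z‖ := by
    refine funext fun z => intervalIntegral.integral_congr fun s hs => ?_
    rw [uIcc_of_le (sq_nonneg _)] at hs
    exact (hba s hs.1).symm
  rw [hP]
  exact hconv.comp_norm hmono
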